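/- arXiv:2201.02873 — 2 statements merged into one kernel-verified Lean document; each statement's English description precedes it below -/
import Mathlib

section
/- Fix a positive integer k, a positive integer r, h > 0 and β ≥ 0. Set X₀ = 0 ∈ ℝ^r and define g₂ : (ℝ^r)^k → ℝ by g₂(x₁, …, x_k) = (1 / ((2π)^{r/2} h^r · k(k+1))) · Σ_{j=1}^k Σ_{l=0, l≠j}^{k} exp(−‖x_j − x_l‖²/(2h)), where x₀ = 0. Then for any index m and any two tuples that agree in all coordinates except the m-th, with all coordinate vectors of both tuples lying in the closed ball of radius β centered at the origin, the values of g₂ differ by at most ξ₂ = (1 − exp(−β²/(2h)) + 2k(1 − exp(−2β²/h))) / ((2π)^{r/2} h^r (k+1)). -/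
open scoped Real BigOperators

/-- Two values of the Gaussian kernel on a ball of radius `R` differ by at most
`1 - exp (-R ^ 2 / (2 * h))`. -/
lemma abs_gaussian_sub_gaussian_le {E : Type*} [SeminormedAddCommGroup E] {h R : ℝ} (hh : 0 < h)
    {u v : E} (hu : ‖u‖ ≤ R) (hv : ‖v‖ ≤ R) :
    |Real.exp (-‖u‖ ^ 2 / (2 * h)) - Real.exp (-‖v‖ ^ 2 / (2 * h))| ≤
      1 - Real.exp (-R ^ 2 / (2 * h)) := by
  have bounds : ∀ w : E, ‖w‖ ≤ R → Real.exp (-R ^ 2 / (2 * h)) ≤ Real.exp (-‖w‖ ^ 2 / (2 * h)) ∧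
      Real.exp (-‖w‖ ^ 2 / (2 * h)) ≤ 1 := by
    refine fun w hw => ⟨by gcongr, Real.exp_le_one_iff.2 ?_⟩
    exact div_nonpos_of_nonpos_of_nonneg (neg_nonpos.2 (sq_nonneg _)) (by positivity)
  obtain ⟨hu₁, hu₂⟩ := bounds u hu
  obtain ⟨hv₁, hv₂⟩ := bounds v hv
  rw [abs_le]
  constructor <;> linarith

/-- The sum of Gaussian kernel values at `x j` over the other points of `{0, x 0, …, x (k - 1)}`
splits off the term of the origin. -/
lemma sum_erase_gaussian_cons_zero {E : Type*} [SeminormedAddCommGroup E] {k : ℕ} (h : ℝ)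
    (x : Fin k → E) (j : Fin k) :
    ∑ l ∈ Finset.univ.erase j.succ,
      Real.exp (-‖(Fin.cons 0 x : Fin (k + 1) → E) j.succ -
        (Fin.cons 0 x : Fin (k + 1) → E) l‖ ^ 2 / (2 * h)) =
      Real.exp (-‖x j‖ ^ 2 / (2 * h)) + ∑ i, Real.exp (-‖x j - x i‖ ^ 2 / (2 * h)) - 1 := by
  rw [Finset.sum_erase_eq_sub (Finset.mem_univ _), Fin.sum_univ_succ]
  simp

/-- Bounded-difference property (with constant ξ₂) of the averaged neighborhood
Gaussian kernel density estimate `g₂`, from Appendix C of the LoMar paper.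
Here the kernel center is `x₀ = 0` (encoded via `Fin.cons 0 x`). -/
theorem averaged_kde_bounded_difference
    (k r : ℕ) (hk : 0 < k) (hr : 0 < r) (h β : ℝ) (hh : 0 < h) (hβ : 0 ≤ β)
    (g₂ : (Fin k → EuclideanSpace ℝ (Fin r)) → ℝ)
    (hg₂ : ∀ x, g₂ x = (1 / ((2 * Real.pi) ^ ((r : ℝ) / 2) * h ^ r * (k * (k + 1)))) *
        ∑ j : Fin k, ∑ l ∈ Finset.univ.erase j.succ,
          Real.exp (-‖(Fin.cons 0 x : Fin (k + 1) → EuclideanSpace ℝ (Fin r)) j.succ -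
            (Fin.cons 0 x : Fin (k + 1) → EuclideanSpace ℝ (Fin r)) l‖ ^ 2 / (2 * h)))
    (m : Fin k) (x y : Fin k → EuclideanSpace ℝ (Fin r))
    (hagree : ∀ j : Fin k, j ≠ m → x j = y j)
    (hx : ∀ j : Fin k, x j ∈ Metric.closedBall (0 : EuclideanSpace ℝ (Fin r)) β)
    (hy : ∀ j : Fin k, y j ∈ Metric.closedBall (0 : EuclideanSpace ℝ (Fin r)) β) :
    |g₂ x - g₂ y| ≤
      (1 - Real.exp (-β ^ 2 / (2 * h)) + 2 * k * (1 - Real.exp (-(2 * β ^ 2) / h))) /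
        ((2 * Real.pi) ^ ((r : ℝ) / 2) * h ^ r * (k + 1)) := by
  set A := 1 - Real.exp (-β ^ 2 / (2 * h))
  set B := 1 - Real.exp (-(2 * β ^ 2) / h) with hB
  have hB_eq : B = 1 - Real.exp (-(2 * β) ^ 2 / (2 * h)) := by
    rw [hB]
    congr 2
    field_simp
  have hB_nonneg : 0 ≤ B := by
    rw [hB, sub_nonneg, Real.exp_le_one_iff]
    exact div_nonpos_of_nonpos_of_nonneg (by nlinarith [sq_nonneg β]) hh.le
  simp only [mem_closedBall_zero_iff] at hx hy
  have origin_le : ∀ j, |Real.exp (-‖x j‖ ^ 2 / (2 * h)) - Real.exp (-‖y j‖ ^ 2 / (2 * h))| ≤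
      if j = m then A else 0 := by
    intro j
    split_ifs with hj
    · exact abs_gaussian_sub_gaussian_le hh (hx j) (hy j)
    · simp [hagree j hj]
  have pair_le : ∀ j i, |Real.exp (-‖x j - x i‖ ^ 2 / (2 * h)) -
      Real.exp (-‖y j - y i‖ ^ 2 / (2 * h))| ≤
      (if j = m then B else 0) + (if i = m then B else 0) := by
    intro j i
    have hle : |Real.exp (-‖x j - x i‖ ^ 2 / (2 * h)) -
        Real.exp (-‖y j - y i‖ ^ 2 / (2 * h))| ≤ B := by
      rw [hB_eq]
      apply abs_gaussian_sub_gaussian_le hh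
      · linarith [norm_sub_le (x j) (x i), hx j, hx i]
      · linarith [norm_sub_le (y j) (y i), hy j, hy i]
    by_cases hj : j = m
    · rw [if_pos hj]
      split_ifs <;> linarith
    · by_cases hi : i = m
      · rw [if_neg hj, if_pos hi]
        linarith
      · simp [hj, hi, hagree j hj, hagree i hi]
  have sum_le : |∑ j, (Real.exp (-‖x j‖ ^ 2 / (2 * h)) +
        ∑ i, Real.exp (-‖x j - x i‖ ^ 2 / (2 * h)) - 1) -
      ∑ j, (Real.exp (-‖y j‖ ^ 2 / (2 * h)) +
        ∑ i, Real.exp (-‖y j - y i‖ ^ 2 / (2 * h)) - 1)| ≤ A + 2 * k * B := by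
    rw [← Finset.sum_sub_distrib]
    calc _ ≤ ∑ j, ((if j = m then A else 0) +
          ∑ i, ((if j = m then B else 0) + (if i = m then B else 0))) := by
          refine (Finset.abs_sum_le_sum_abs _ _).trans (Finset.sum_le_sum fun j _ => ?_)
          rw [sub_sub_sub_cancel_right, add_sub_add_comm, ← Finset.sum_sub_distrib]
          refine (abs_add_le _ _).trans (add_le_add (origin_le j) ?_)
          exact (Finset.abs_sum_le_sum_abs _ _).trans (Finset.sum_le_sum fun i _ => pair_le j i)
      _ = A + 2 * k * B := by
          simp [Finset.sum_add_distrib]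
          ring
  have hk_one : (1 : ℝ) ≤ k := by exact_mod_cast hk
  have hc : 0 < (2 * Real.pi) ^ ((r : ℝ) / 2) * h ^ r := by positivity
  simp only [hg₂, sum_erase_gaussian_cons_zero]
  rw [← mul_sub, abs_mul, abs_of_nonneg (by positivity), one_div_mul_eq_div]
  have hN := (abs_nonneg _).trans sum_le
  gcongr
  nlinarith
end

section
/- Fix a positive integer k, a positive integer r, h > 0, β ≥ 0, and a real number ε ≥ 0. With g₁ and g₂ as follows: g₁(x₁, …, x_k) = (1 / ((2π)^{r/2} h^r (k+1))) · Σ_{j=1}^k exp(−‖x_j‖²/(2h)), and g₂(x₁, …, x_k) = (1 / ((2π)^{r/2} h^r · k(k+1))) · Σ_{j=1}^k Σ_{l=0, l≠j}^{k} exp(−‖x_j − x_l‖²/(2h)) with x₀ = 0, define g = g₂ − ε·g₁. Then for any index m and any two tuples in (ℝ^r)^k that agree in all coordinates except the m-th, the values of g differ by at most ξ = (2k + ε + 1) / ((2π)^{r/2} h^r (k+1)). -/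
open scoped Real BigOperators

/-- Values of a Gaussian kernel lie in `[0, 1]`, so they differ by at most `1`. -/
lemma abs_exp_neg_sq_sub_exp_neg_sq_le_one (a b : ℝ) {h : ℝ} (hh : 0 < h) :
    |Real.exp (-a ^ 2 / (2 * h)) - Real.exp (-b ^ 2 / (2 * h))| ≤ 1 := by
  have exp_le_one (c : ℝ) : Real.exp (-c ^ 2 / (2 * h)) ≤ 1 :=
    Real.exp_le_one_iff.2 <|
      div_nonpos_of_nonpos_of_nonneg (neg_nonpos.2 (sq_nonneg c)) (by positivity)
  exact abs_sub_le_of_nonneg_of_le (Real.exp_pos _).le (exp_le_one a)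
    (Real.exp_pos _).le (exp_le_one b)

/-- Sums whose terms differ by at most `c` differ by at most `c` times the number of terms. -/
lemma Finset.abs_sum_sub_sum_le_card_mul {ι : Type*} (s : Finset ι) (u v : ι → ℝ) {c : ℝ}
    (huv : ∀ i ∈ s, |u i - v i| ≤ c) :
    |∑ i ∈ s, u i - ∑ i ∈ s, v i| ≤ s.card * c := by
  rw [← Finset.sum_sub_distrib, ← nsmul_eq_mul]
  exact (Finset.abs_sum_le_sum_abs _ _).trans (Finset.sum_le_card_nsmul s _ c huv)

/-- Bounded-difference property (with constant ξ) of `g = g₂ - ε·g₁`, the function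
to which McDiarmid's inequality is applied in the proof of Theorem 1 of the LoMar
paper. -/
theorem lomar_g_bounded_difference
    (k r : ℕ) (hk : 0 < k) (hr : 0 < r) (h β ε : ℝ) (hh : 0 < h) (hβ : 0 ≤ β)
    (hε : 0 ≤ ε)
    (g₁ g₂ : (Fin k → EuclideanSpace ℝ (Fin r)) → ℝ)
    (hg₁ : ∀ x, g₁ x = (1 / ((2 * Real.pi) ^ ((r : ℝ) / 2) * h ^ r * (k + 1))) *
        ∑ j : Fin k, Real.exp (-‖x j‖ ^ 2 / (2 * h)))
    (hg₂ : ∀ x, g₂ x = (1 / ((2 * Real.pi) ^ ((r : ℝ) / 2) * h ^ r * (k * (k + 1)))) *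
        ∑ j : Fin k, ∑ l ∈ Finset.univ.erase j.succ,
          Real.exp (-‖(Fin.cons 0 x : Fin (k + 1) → EuclideanSpace ℝ (Fin r)) j.succ -
            (Fin.cons 0 x : Fin (k + 1) → EuclideanSpace ℝ (Fin r)) l‖ ^ 2 / (2 * h)))
    (g : (Fin k → EuclideanSpace ℝ (Fin r)) → ℝ)
    (hg : ∀ x, g x = g₂ x - ε * g₁ x)
    (m : Fin k) (x y : Fin k → EuclideanSpace ℝ (Fin r))
    (hagree : ∀ j : Fin k, j ≠ m → x j = y j) :
    |g x - g y| ≤ (2 * k + ε + 1) /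
      ((2 * Real.pi) ^ ((r : ℝ) / 2) * h ^ r * (k + 1)) := by
  have hcenter : |∑ j : Fin k, Real.exp (-‖x j‖ ^ 2 / (2 * h)) -
      ∑ j : Fin k, Real.exp (-‖y j‖ ^ 2 / (2 * h))| ≤ 1 := by
    rw [← Finset.sum_sub_distrib, Finset.sum_eq_single m
      (fun j _ hj => by rw [hagree j hj, sub_self]) (by simp)]
    exact abs_exp_neg_sq_sub_exp_neg_sq_le_one _ _ hh
  -- Bounding all `k * k` terms of the double sum already suffices.
  have hpair : |(∑ j : Fin k, ∑ l ∈ Finset.univ.erase j.succ,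
        Real.exp (-‖(Fin.cons 0 x : Fin (k + 1) → EuclideanSpace ℝ (Fin r)) j.succ -
          (Fin.cons 0 x : Fin (k + 1) → EuclideanSpace ℝ (Fin r)) l‖ ^ 2 / (2 * h))) -
      ∑ j : Fin k, ∑ l ∈ Finset.univ.erase j.succ,
        Real.exp (-‖(Fin.cons 0 y : Fin (k + 1) → EuclideanSpace ℝ (Fin r)) j.succ -
          (Fin.cons 0 y : Fin (k + 1) → EuclideanSpace ℝ (Fin r)) l‖ ^ 2 / (2 * h))| ≤
      k * k := by
    have hrow := Finset.abs_sum_sub_sum_le_card_mul (Finset.univ : Finset (Fin k)) (c := k)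
    rw [Finset.card_univ, Fintype.card_fin] at hrow
    refine hrow _ _ fun j _ => ?_
    refine (Finset.abs_sum_sub_sum_le_card_mul _ _ _ fun l _ =>
      abs_exp_neg_sq_sub_exp_neg_sq_le_one _ _ hh).trans_eq ?_
    simp [Finset.card_erase_of_mem]
  rw [hg, hg, hg₁, hg₁, hg₂, hg₂]
  generalize (∑ j : Fin k, Real.exp (-‖x j‖ ^ 2 / (2 * h))) = a at *
  generalize (∑ j : Fin k, Real.exp (-‖y j‖ ^ 2 / (2 * h))) = b at *
  generalize (∑ j : Fin k, ∑ l ∈ Finset.univ.erase j.succ, Real.exp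
    (-‖(Fin.cons 0 x : Fin (k + 1) → EuclideanSpace ℝ (Fin r)) j.succ -
      (Fin.cons 0 x : Fin (k + 1) → EuclideanSpace ℝ (Fin r)) l‖ ^ 2 / (2 * h))) = p at *
  generalize (∑ j : Fin k, ∑ l ∈ Finset.univ.erase j.succ, Real.exp
    (-‖(Fin.cons 0 y : Fin (k + 1) → EuclideanSpace ℝ (Fin r)) j.succ -
      (Fin.cons 0 y : Fin (k + 1) → EuclideanSpace ℝ (Fin r)) l‖ ^ 2 / (2 * h))) = q at *
  have hk' : (0 : ℝ) < k := Nat.cast_pos.2 hk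
  have hD : 0 < (2 * Real.pi) ^ ((r : ℝ) / 2) * h ^ r := by positivity
  generalize (2 * Real.pi) ^ ((r : ℝ) / 2) * h ^ r = D at *
  have hsplit : 1 / (D * (k * (k + 1))) * p - ε * (1 / (D * (k + 1)) * a) -
      (1 / (D * (k * (k + 1))) * q - ε * (1 / (D * (k + 1)) * b)) =
      ((p - q) / k - ε * (a - b)) / (D * (k + 1)) := by
    field_simp
    ring
  rw [hsplit, abs_div, abs_of_pos (show 0 < D * ((k : ℝ) + 1) by positivity)]
  gcongr
  calc |(p - q) / k - ε * (a - b)| ≤ |(p - q) / k| + |ε * (a - b)| := abs_sub _ _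
    _ = |p - q| / k + ε * |a - b| := by
      rw [abs_div, abs_mul, abs_of_pos hk', abs_of_nonneg hε]
    _ ≤ k + ε * 1 := by
      gcongr
      exact (div_le_iff₀ hk').2 hpair
    _ ≤ 2 * k + ε + 1 := by linarith
end
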